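/- Let k be a field and R a commutative k-algebra which is an integral domain, such that every element of the fraction field of R that is algebraic over k lies in (the image of) k. Let M be a torsion-free R-module, let V ⊆ M be a nonzero finite-dimensional k-linear subspace, and let W ⊆ R be a k-linear subspace with dim_k W ≥ 2. Then the k-linear span of { w • v : w ∈ W, v ∈ V } inside M has k-dimension strictly greater than dim_k V. -/

import Mathlib

/-- Algebraic core of Lemma 5.5 ('auxiliary inequality'): let `R` be a commutative
`k`-algebra which is a domain such that every element of its fraction field `K` that is
algebraic over `k` lies in `k`, let `M` be a torsion-free `R`-module, `V ⊆ M` a nonzero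
finite-dimensional `k`-subspace, and `W ⊆ R` a `k`-subspace with `dim_k W ≥ 2`.
Then the span of `{w • v | w ∈ W, v ∈ V}` has `k`-dimension strictly greater than
`dim_k V`. -/
theorem stmt_10 (k : Type*) [Field k] (R : Type*) [CommRing R] [IsDomain R] [Algebra k R]
    (K : Type*) [Field K] [Algebra R K] [IsFractionRing R K]
    [Algebra k K] [IsScalarTower k R K]
    (halg : ∀ x : K, IsAlgebraic k x → ∃ c : k, algebraMap k K c = x)
    (M : Type*) [AddCommGroup M] [Module R M] [NoZeroSMulDivisors R M]
    [Module k M] [IsScalarTower k R M]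
    (V : Submodule k M) (hV : V ≠ ⊥) [FiniteDimensional k ↥V]
    (W : Submodule k R) (hW : 2 ≤ Module.rank k ↥W) :
    Module.rank k ↥V <
      Module.rank k ↥(Submodule.span k { m : M | ∃ w ∈ W, ∃ v ∈ V, m = w • v }) := by
  by_contra hcon
  rw [not_lt] at hcon
  set U := Submodule.span k { m : M | ∃ w ∈ W, ∃ v ∈ V, m = w • v } with hU
  have hW1 : 1 < Module.rank k ↥W := lt_of_lt_of_le (by norm_num) hW
  haveI : Nontrivial ↥W := rank_pos_iff_nontrivial.mp (lt_trans (by norm_num) hW1)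
  obtain ⟨s, hs⟩ := exists_ne (0 : ↥W)
  obtain ⟨t, hst⟩ := exists_linearIndependent_pair_of_one_lt_rank hW1 hs
  have hs0 : (s : R) ≠ 0 := by simpa using hs
  haveI : FiniteDimensional k ↥U := by
    rw [FiniteDimensional, ← Module.rank_lt_aleph0_iff]
    exact lt_of_le_of_lt hcon (Module.rank_lt_aleph0 k V)
  have hmem : ∀ (w : ↥W) (v : ↥V), (w : R) • (v : M) ∈ U := fun w v =>
    Submodule.subset_span ⟨w, w.2, v, v.2, rfl⟩
  let f : ↥W → (↥V →ₗ[k] ↥U) := fun w =>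
    LinearMap.codRestrict U (((LinearMap.lsmul R M (w : R)).restrictScalars k).comp V.subtype)
      (fun v => hmem w v)
  have hf : ∀ w v, ((f w v : ↥U) : M) = (w : R) • (v : M) := fun w v => rfl
  have hinj : Function.Injective (f s) := by
    intro a b hab
    have h := congrArg (Subtype.val) hab
    rw [hf, hf] at h
    have h2 : (s : R) • ((a : M) - b) = 0 := by rw [smul_sub, h, sub_self]
    rcases smul_eq_zero.mp h2 with h3 | h3
    · exact absurd h3 hs0
    · exact Subtype.ext (sub_eq_zero.mp h3)
  have hdim : Module.finrank k ↥V = Module.finrank k ↥U := by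
    apply le_antisymm (LinearMap.finrank_le_finrank_of_injective hinj)
    rw [← Module.finrank_eq_rank, ← Module.finrank_eq_rank] at hcon
    exact_mod_cast hcon
  have hsurj : Function.Surjective (f s) :=
    (LinearMap.injective_iff_surjective_of_finrank_eq_finrank hdim).mp hinj
  let e : ↥V ≃ₗ[k] ↥U := LinearEquiv.ofBijective (f s) ⟨hinj, hsurj⟩
  let φ : Module.End k ↥V := e.symm.toLinearMap.comp (f t)
  have hφ : ∀ v : ↥V, (s : R) • ((φ v : ↥V) : M) = (t : R) • (v : M) := by
    intro v
    have h : e (φ v) = f t v := e.apply_symm_apply _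
    exact congrArg Subtype.val h
  have hpow : ∀ (i : ℕ) (v : ↥V),
      (s : R) ^ i • (((φ ^ i) v : ↥V) : M) = (t : R) ^ i • (v : M) := by
    intro i
    induction i with
    | zero => intro v; simp
    | succ n ih =>
      intro v
      rw [pow_succ φ, Module.End.mul_apply, pow_succ, mul_comm, mul_smul, ih, smul_comm, hφ,
        ← mul_smul, ← pow_succ]
  obtain ⟨v, hv, hv0⟩ := Submodule.exists_mem_ne_zero_of_ne_bot hV
  set p := minpoly k φ with hp
  have hp0 : p ≠ 0 := minpoly.ne_zero (Algebra.IsIntegral.isIntegral φ)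
  have hsum : ∑ i ∈ Finset.range (p.natDegree + 1), p.coeff i • (φ ^ i) = 0 := by
    rw [← Polynomial.aeval_eq_sum_range]; exact minpoly.aeval k φ
  have hsumv : ∑ i ∈ Finset.range (p.natDegree + 1),
      p.coeff i • (((φ ^ i) ⟨v, hv⟩ : ↥V) : M) = 0 := by
    have h := congrArg (fun g : Module.End k ↥V => ((g ⟨v, hv⟩ : ↥V) : M)) hsum
    simpa [LinearMap.sum_apply] using h
  have hR : (∑ i ∈ Finset.range (p.natDegree + 1),
      p.coeff i • ((s : R) ^ (p.natDegree - i) * (t : R) ^ i)) • v = 0 := by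
    rw [Finset.sum_smul]
    have h := congrArg (fun m : M => (s : R) ^ p.natDegree • m) hsumv
    simp only [Finset.smul_sum, smul_zero] at h
    rw [← h]
    refine Finset.sum_congr rfl fun i hi => ?_
    have hi' : i ≤ p.natDegree := by simpa [Nat.lt_succ_iff] using hi
    have h1 := hpow i ⟨v, hv⟩
    simp only at h1
    rw [smul_assoc, mul_smul, ← h1, ← mul_smul, ← pow_add, Nat.sub_add_cancel hi']
    rw [← algebraMap_smul R (p.coeff i), ← algebraMap_smul R (p.coeff i), smul_comm]
  have hR0 := (smul_eq_zero.mp hR).resolve_right hv0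
  have hsK : algebraMap R K s ≠ 0 := by
    simpa using (map_ne_zero_iff _ (IsFractionRing.injective R K)).mpr hs0
  have hx : IsAlgebraic k (algebraMap R K t / algebraMap R K s) := by
    refine ⟨p, hp0, ?_⟩
    rw [Polynomial.aeval_eq_sum_range]
    have h := congrArg (algebraMap R K) hR0
    rw [map_sum, map_zero] at h
    refine (mul_eq_zero_iff_left (pow_ne_zero p.natDegree hsK)).mp ?_
    rw [← h, Finset.mul_sum]
    refine Finset.sum_congr rfl fun i hi => ?_
    have hi' : i ≤ p.natDegree := by simpa [Nat.lt_succ_iff] using hi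
    rw [Algebra.smul_def, Algebra.smul_def, map_mul, map_mul, map_pow, map_pow,
      ← IsScalarTower.algebraMap_apply, div_pow]
    obtain ⟨j, hj⟩ := Nat.exists_eq_add_of_le hi'
    rw [hj, Nat.add_sub_cancel_left, pow_add]
    field_simp
  obtain ⟨c, hc⟩ := halg _ hx
  rw [eq_div_iff hsK, IsScalarTower.algebraMap_apply k R K, ← map_mul] at hc
  have hc' : algebraMap k R c * s = t := IsFractionRing.injective R K hc
  rw [LinearIndependent.pair_iff] at hst
  have := hst c (-1) (by
    apply Subtype.ext
    simp [Algebra.smul_def, hc'])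
  simpa using this.2
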